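/- Let T be a random map on (X, 𝒜, m) with parameter space (W, ν). Assume the first return random map R of T on a measurable set A ⊂ X with m(A) > 0 is well defined, and that R has an invariant probability measure μ_A. Define μ(D) = Σ_{n≥0} ∫_A Ũ_T^n(U_T 1_D)(x) μ_A(dx) for D ∈ 𝒜. Then μ is a σ-finite invariant measure for T, i.e., P_*μ = μ and μ is σ-finite. -/

import Mathlib

open MeasureTheory Set ENNReal

noncomputable section

/-- Orbit of a point under successive application of the maps `S t` along a finite word of
parameters: `orbL S [t₁, …, t_k] x = S t_k (⋯ (S t₁ x))`. -/
def orbL {P α : Type*} (S : P → α → α) : List P → α → α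
  | [], x => x
  | t :: ts, x => orbL S ts (S t x)

/-- The probability `p̂_n(x)` of first return to `A` after exactly `n` steps. -/
def firstReturnP {W X : Type*} [MeasurableSpace W] (ν : Measure W) [SigmaFinite ν]
    (T : W → X → X) (p : W → X → ℝ≥0∞) (A : Set X) (n : ℕ) (x : X) : ℝ≥0∞ :=
  ∫⁻ u : Fin n → W,
    ∏ k : Fin n,
      (p (u k) (orbL T (List.take (k : ℕ) (List.ofFn u)) x) *
        Set.indicator (if (k : ℕ) + 1 < n then Aᶜ else A) (fun _ => (1 : ℝ≥0∞))
          (orbL T (List.take ((k : ℕ) + 1) (List.ofFn u)) x))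
    ∂(Measure.pi fun _ : Fin n => ν)

/-- The transition function `P_R(x,D)` of the first return random map `R` of `T` on `A`. -/
def firstReturnTrans {W X : Type*} [MeasurableSpace W] (ν : Measure W) [SigmaFinite ν]
    (T : W → X → X) (p : W → X → ℝ≥0∞) (A : Set X) (x : X) (D : Set X) : ℝ≥0∞ :=
  ∑' n : ℕ,
    ∫⁻ u : Fin (n + 1) → W,
      ∏ k : Fin (n + 1),
        (p (u k) (orbL T (List.take (k : ℕ) (List.ofFn u)) x) *
          Set.indicator (if (k : ℕ) + 1 < n + 1 then Aᶜ else A ∩ D) (fun _ => (1 : ℝ≥0∞))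
            (orbL T (List.take ((k : ℕ) + 1) (List.ofFn u)) x))
      ∂(Measure.pi fun _ : Fin (n + 1) => ν)

open ProbabilityTheory

section Taboo

variable {X : Type*} [MeasurableSpace X]

/-- The transition operator of `κ` killed upon entering `A`. -/
def tabooOp (κ : Kernel X X) (A : Set X) (f : X → ℝ≥0∞) (y : X) : ℝ≥0∞ :=
  ∫⁻ z in Aᶜ, f z ∂κ y

/-- The law at time `n`, from the initial law `μ`, of the chain killed upon entering `A`
at a positive time. -/
def tabooLaw (κ : Kernel X X) (A : Set X) (μ : Measure X) : ℕ → Measure X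
  | 0 => μ
  | n + 1 => ((tabooLaw κ A μ n).bind κ).restrict Aᶜ

/-- The expected number of visits at positive times up to the first entrance in `A`. -/
def occupation (κ : Kernel X X) (A : Set X) (μ : Measure X) : Measure X :=
  Measure.sum fun n => (tabooLaw κ A μ n).bind κ

variable {κ : Kernel X X} {A : Set X} {μ : Measure X}

lemma measurable_tabooOp (hA : MeasurableSet A) {f : X → ℝ≥0∞} (hf : Measurable f) :
    Measurable (tabooOp κ A f) := by
  have h : tabooOp κ A f = fun y => ∫⁻ z, Aᶜ.indicator f z ∂κ y :=
    funext fun y => (lintegral_indicator hA.compl f).symm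
  rw [h]
  exact (hf.indicator hA.compl).lintegral_kernel

lemma measurable_iterate_tabooOp (hA : MeasurableSet A) {f : X → ℝ≥0∞} (hf : Measurable f)
    (n : ℕ) : Measurable ((tabooOp κ A)^[n] f) := by
  induction n with
  | zero => exact hf
  | succ n ih =>
    rw [Function.iterate_succ_apply']
    exact measurable_tabooOp hA ih

lemma lintegral_tabooLaw (hA : MeasurableSet A) (n : ℕ) {f : X → ℝ≥0∞} (hf : Measurable f) :
    ∫⁻ x, f x ∂tabooLaw κ A μ n = ∫⁻ x, (tabooOp κ A)^[n] f x ∂μ := by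
  induction n generalizing f with
  | zero => rfl
  | succ n ih =>
    rw [Function.iterate_succ_apply, ← ih (measurable_tabooOp hA hf), tabooLaw,
      ← lintegral_indicator hA.compl,
      Measure.lintegral_bind κ.measurable.aemeasurable (hf.indicator hA.compl).aemeasurable]
    simp only [lintegral_indicator hA.compl]
    rfl

lemma occupation_apply (hA : MeasurableSet A) {D : Set X} (hD : MeasurableSet D) :
    occupation κ A μ D = ∑' n, ∫⁻ x, (tabooOp κ A)^[n] (fun y => κ y D) x ∂μ := by
  rw [occupation, Measure.sum_apply _ hD]
  refine tsum_congr fun n => ?_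
  rw [Measure.bind_apply hD κ.measurable.aemeasurable,
    lintegral_tabooLaw hA n (κ.measurable_coe hD)]

lemma occupation_restrict_compl (hA : MeasurableSet A) :
    (occupation κ A μ).restrict Aᶜ = Measure.sum fun n => tabooLaw κ A μ (n + 1) := by
  rw [occupation, Measure.restrict_sum _ hA.compl]
  rfl

/-- If the law of the first entrance in `A` is the initial law, then the occupation measure
also counts the visits at times `0, …, τ - 1`. -/
lemma occupation_eq_sum (hA : MeasurableSet A) (h : (occupation κ A μ).restrict A = μ) :
    occupation κ A μ = Measure.sum (tabooLaw κ A μ) := by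
  rw [← Measure.restrict_add_restrict_compl (μ := occupation κ A μ) hA, h,
    occupation_restrict_compl hA]
  ext D hD
  rw [Measure.add_apply, Measure.sum_apply _ hD, Measure.sum_apply _ hD]
  exact (tsum_eq_zero_add' (f := fun n => tabooLaw κ A μ n D) ENNReal.summable).symm

lemma occupation_bind (hA : MeasurableSet A) (h : (occupation κ A μ).restrict A = μ) :
    (occupation κ A μ).bind κ = occupation κ A μ := by
  ext D hD
  rw [Measure.bind_apply hD κ.measurable.aemeasurable, occupation_eq_sum hA h,
    lintegral_sum_measure, ← occupation_eq_sum hA h, occupation, Measure.sum_apply _ hD]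
  exact tsum_congr fun n => (Measure.bind_apply hD κ.measurable.aemeasurable).symm

/-- The probability of hitting `A` at a positive time. -/
def hitProb (κ : Kernel X X) (A : Set X) (x : X) : ℝ≥0∞ :=
  ∑' n : ℕ, (tabooOp κ A)^[n] (fun y => κ y A) x

lemma measurable_hitProb (hA : MeasurableSet A) : Measurable (hitProb κ A) :=
  Measurable.tsum fun n => measurable_iterate_tabooOp hA (κ.measurable_coe hA) n

lemma hitProb_eq (hA : MeasurableSet A) (x : X) :
    hitProb κ A x = κ x A + tabooOp κ A (hitProb κ A) x := by
  rw [hitProb, tsum_eq_zero_add' ENNReal.summable]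
  congr 1
  simp only [Function.iterate_succ_apply']
  exact (lintegral_tsum fun n =>
    (measurable_iterate_tabooOp hA (κ.measurable_coe hA) n).aemeasurable).symm

lemma measure_add_tabooOp_le_one [IsMarkovKernel κ] (hA : MeasurableSet A) {f : X → ℝ≥0∞}
    (hf : ∀ x, f x ≤ 1) (x : X) : κ x A + tabooOp κ A f x ≤ 1 := by
  calc κ x A + tabooOp κ A f x ≤ κ x A + ∫⁻ _ in Aᶜ, 1 ∂κ x := by
        gcongr
        exact lintegral_mono hf
    _ = 1 := by rw [setLIntegral_one, measure_add_measure_compl hA, measure_univ]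

lemma hitProb_le_one [IsMarkovKernel κ] (hA : MeasurableSet A) (x : X) : hitProb κ A x ≤ 1 := by
  rw [hitProb, ENNReal.tsum_eq_iSup_nat]
  refine iSup_le fun n => ?_
  induction n generalizing x with
  | zero => simp
  | succ n ih =>
    rw [Finset.sum_range_succ']
    simp only [Function.iterate_succ_apply', Function.iterate_zero, id_eq]
    rw [add_comm]
    refine le_trans (le_of_eq ?_) (measure_add_tabooOp_le_one (κ := κ) hA ih x)
    congr 1
    exact (lintegral_finsetSum _ fun n _ =>
      measurable_iterate_tabooOp hA (κ.measurable_coe hA) n).symm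

lemma iterate_tabooOp_add_hitProb_le_one [IsMarkovKernel κ] (hA : MeasurableSet A)
    {f : X → ℝ≥0∞} (hfm : Measurable f) (hf : ∀ x, f x + hitProb κ A x ≤ 1) (n : ℕ) (x : X) :
    (tabooOp κ A)^[n] f x + hitProb κ A x ≤ 1 := by
  induction n generalizing x with
  | zero => exact hf x
  | succ n ih =>
    rw [Function.iterate_succ_apply', hitProb_eq hA, add_left_comm]
    refine le_trans (le_of_eq ?_) (measure_add_tabooOp_le_one (κ := κ) hA ih x)
    congr 1
    exact (lintegral_add_left (measurable_iterate_tabooOp hA hfm n) _).symm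

lemma lintegral_hitProb (hA : MeasurableSet A) :
    ∫⁻ x, hitProb κ A x ∂μ = occupation κ A μ A := by
  rw [occupation_apply hA hA]
  exact lintegral_tsum fun n =>
    (measurable_iterate_tabooOp hA (κ.measurable_coe hA) n).aemeasurable

lemma occupation_hitProb_eq_zero [IsMarkovKernel κ] [IsProbabilityMeasure μ]
    (hA : MeasurableSet A) (h : (occupation κ A μ).restrict A = μ) :
    occupation κ A μ {x | hitProb κ A x = 0} = 0 := by
  have hN : MeasurableSet {x | hitProb κ A x = 0} :=
    measurable_hitProb hA (measurableSet_singleton 0)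
  have hocc : occupation κ A μ A = 1 := by
    rw [← Measure.restrict_apply_univ, h, measure_univ]
  rw [occupation_eq_sum hA h, Measure.sum_apply _ hN, ENNReal.tsum_eq_zero]
  intro n
  have hind : Measurable ({x | hitProb κ A x = 0}.indicator (1 : X → ℝ≥0∞)) :=
    measurable_one.indicator hN
  rw [← lintegral_indicator_one hN, lintegral_tabooLaw hA n hind]
  have hle : ∫⁻ x, ((tabooOp κ A)^[n] ({x | hitProb κ A x = 0}.indicator 1) x
      + hitProb κ A x) ∂μ ≤ ∫⁻ _, 1 ∂μ := by
    refine lintegral_mono (iterate_tabooOp_add_hitProb_le_one hA hind (fun x => ?_) n)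
    by_cases hx : hitProb κ A x = 0
    · simp [hx]
    · simpa [hx] using hitProb_le_one hA x
  rw [lintegral_add_left (measurable_iterate_tabooOp hA hind n), lintegral_hitProb hA, hocc,
    lintegral_one, measure_univ] at hle
  by_contra hne
  exact absurd hle (not_le.2 (by
    rw [add_comm]; exact ENNReal.lt_add_right ENNReal.one_ne_top hne))

lemma lintegral_iterate_tabooOp_le {m : Measure X} (hA : MeasurableSet A) (hm : m.bind κ = m)
    {f : X → ℝ≥0∞} (hf : Measurable f) (n : ℕ) :
    ∫⁻ x, (tabooOp κ A)^[n] f x ∂m ≤ ∫⁻ x, f x ∂m := by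
  induction n with
  | zero => rfl
  | succ n ih =>
    rw [Function.iterate_succ_apply']
    have hn := measurable_iterate_tabooOp (κ := κ) hA hf n
    calc ∫⁻ x, tabooOp κ A ((tabooOp κ A)^[n] f) x ∂m
        ≤ ∫⁻ x, ∫⁻ z, (tabooOp κ A)^[n] f z ∂κ x ∂m :=
          lintegral_mono fun x => setLIntegral_le_lintegral _ _
      _ = ∫⁻ x, (tabooOp κ A)^[n] f x ∂m := by
          rw [← Measure.lintegral_bind κ.measurable.aemeasurable hn.aemeasurable, hm]
      _ ≤ _ := ih

lemma sigmaFinite_occupation [IsMarkovKernel κ] [IsProbabilityMeasure μ]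
    (hA : MeasurableSet A) (h : (occupation κ A μ).restrict A = μ) :
    SigmaFinite (occupation κ A μ) := by
  set g : ℕ → X → ℝ≥0∞ := fun n => (tabooOp κ A)^[n] fun y => κ y A
  have hg (n) : Measurable (g n) := measurable_iterate_tabooOp hA (κ.measurable_coe hA) n
  have hocc : occupation κ A μ A = 1 := by
    rw [← Measure.restrict_apply_univ, h, measure_univ]
  have hinv := occupation_bind hA h
  have hint (n) : ∫⁻ x, g n x ∂occupation κ A μ ≠ ⊤ := by
    refine ne_top_of_le_ne_top ENNReal.one_ne_top
      ((lintegral_iterate_tabooOp_le hA hinv (κ.measurable_coe hA) n).trans_eq ?_)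
    rw [← Measure.bind_apply hA κ.measurable.aemeasurable, hinv, hocc]
  refine Measure.sigmaFinite_of_countable (S := insert {x | hitProb κ A x = 0}
    (range fun q : ℕ × ℕ => {x | ((q.2 : ℝ≥0∞) + 1)⁻¹ ≤ g q.1 x})) ?_ ?_ ?_
  · exact (countable_range _).insert _
  · rintro s (rfl | ⟨⟨n, k⟩, rfl⟩)
    · rw [occupation_hitProb_eq_zero hA h]
      exact ENNReal.zero_lt_top
    · exact (meas_ge_le_lintegral_div (hg n).aemeasurable (by simp) (by simp)).trans_lt
        (ENNReal.div_lt_top (hint n) (by simp))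
  · refine eq_univ_of_forall fun x => ?_
    by_cases hx : hitProb κ A x = 0
    · exact ⟨_, mem_insert _ _, hx⟩
    · obtain ⟨n, hn⟩ : ∃ n, g n x ≠ 0 := by
        by_contra! hall
        exact hx (ENNReal.tsum_eq_zero.2 hall)
      obtain ⟨k, hk⟩ := ENNReal.exists_inv_nat_lt hn
      exact ⟨_, mem_insert_of_mem _ ⟨(n, k), rfl⟩,
        (ENNReal.inv_le_inv.2 le_self_add).trans hk.le⟩

end Taboo

section RandomMap

variable {W X : Type*} [MeasurableSpace W] [MeasurableSpace X]

/-- The transition kernel of the random map `{T_t; p(t, x)}`. -/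
def randomMapKernel (ν : Measure W) [SigmaFinite ν] (T : W → X → X)
    (hT : Measurable fun q : W × X => T q.1 q.2) (p : W → X → ℝ≥0∞)
    (hp : Measurable fun q : W × X => p q.1 q.2) : Kernel X X where
  toFun x := (ν.withDensity fun t => p t x).map fun t => T t x
  measurable' := by
    refine Measure.measurable_of_measurable_coe _ fun D hD => ?_
    have hTx (x : X) : Measurable fun t => T t x := hT.comp measurable_prodMk_right
    have h (x : X) : ((ν.withDensity fun t => p t x).map fun t => T t x) D
        = ∫⁻ t, ((fun q : W × X => T q.1 q.2) ⁻¹' D).indicator (fun q => p q.1 q.2) (t, x) ∂ν := by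
      rw [Measure.map_apply (hTx x) hD, withDensity_apply _ (hTx x hD),
        ← lintegral_indicator (hTx x hD)]
      rfl
    simp only [h]
    exact (hp.indicator (hT hD)).lintegral_prod_left'

variable {ν : Measure W} [SigmaFinite ν] {T : W → X → X}
  {hT : Measurable fun q : W × X => T q.1 q.2} {p : W → X → ℝ≥0∞}
  {hp : Measurable fun q : W × X => p q.1 q.2}

lemma lintegral_randomMapKernel {f : X → ℝ≥0∞} (hf : Measurable f) (x : X) :
    ∫⁻ z, f z ∂randomMapKernel ν T hT p hp x = ∫⁻ t, p t x * f (T t x) ∂ν := by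
  have hTx : Measurable fun t => T t x := hT.comp measurable_prodMk_right
  have hpx : Measurable fun t => p t x := hp.comp measurable_prodMk_right
  change ∫⁻ z, f z ∂((ν.withDensity fun t => p t x).map fun t => T t x) = _
  rw [lintegral_map hf hTx, ← Function.comp_def f,
    lintegral_withDensity_eq_lintegral_mul _ hpx (hf.comp hTx)]
  rfl

lemma randomMapKernel_apply {D : Set X} (hD : MeasurableSet D) (x : X) :
    randomMapKernel ν T hT p hp x D
      = ∫⁻ t, p t x * D.indicator (fun _ => (1 : ℝ≥0∞)) (T t x) ∂ν := by
  rw [← lintegral_randomMapKernel (hT := hT) (hp := hp) (measurable_const.indicator hD)]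
  exact (lintegral_indicator_one hD).symm

lemma isMarkovKernel_randomMapKernel (hpP : ∀ x, ∫⁻ t, p t x ∂ν = 1) :
    IsMarkovKernel (randomMapKernel ν T hT p hp) := by
  refine ⟨fun x => ⟨?_⟩⟩
  rw [randomMapKernel_apply MeasurableSet.univ]
  simpa using hpP x

lemma tabooOp_randomMapKernel {A : Set X} (hA : MeasurableSet A) {f : X → ℝ≥0∞}
    (hf : Measurable f) (y : X) :
    tabooOp (randomMapKernel ν T hT p hp) A f y
      = ∫⁻ t, p t y * Aᶜ.indicator f (T t y) ∂ν := by
  rw [tabooOp, ← lintegral_indicator hA.compl,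
    lintegral_randomMapKernel (hf.indicator hA.compl)]

lemma iterate_tabooOp_randomMapKernel {A : Set X} (hA : MeasurableSet A) {f : X → ℝ≥0∞}
    (hf : Measurable f) (n : ℕ) :
    (fun (f : X → ℝ≥0∞) => fun y => ∫⁻ t, p t y * (Set.indicator Aᶜ f) (T t y) ∂ν)^[n] f
      = (tabooOp (randomMapKernel ν T hT p hp) A)^[n] f := by
  induction n with
  | zero => rfl
  | succ n ih =>
    rw [Function.iterate_succ_apply', Function.iterate_succ_apply', ih]
    exact funext fun y =>
      (tabooOp_randomMapKernel hA (measurable_iterate_tabooOp hA hf n) y).symm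

lemma measurable_orbL_take_ofFn (hT : Measurable fun q : W × X => T q.1 q.2) (k n : ℕ) :
    Measurable fun q : (Fin n → W) × X => orbL T ((List.ofFn q.1).take k) q.2 := by
  induction k generalizing n with
  | zero => simpa [orbL] using measurable_snd
  | succ k ih =>
    cases n with
    | zero => simpa [orbL] using measurable_snd
    | succ n =>
      simp only [List.ofFn_succ, List.take_succ_cons, orbL]
      have h1 : Measurable fun q : (Fin (n + 1) → W) × X => fun i : Fin n => q.1 i.succ := by
        fun_prop
      have h2 : Measurable fun q : (Fin (n + 1) → W) × X => T (q.1 0) q.2 :=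
        hT.comp (f := fun q : (Fin (n + 1) → W) × X => (q.1 0, q.2)) (by fun_prop)
      exact (ih n).comp (h1.prodMk h2)

/-- Integrating out the parameters one at a time, the first-entrance probabilities are iterates
of the killed transition operator. -/
lemma lintegral_firstReturn_eq {A B : Set X} (hA : MeasurableSet A) (hB : MeasurableSet B)
    (n : ℕ) (x : X) :
    ∫⁻ u : Fin (n + 1) → W,
      ∏ k : Fin (n + 1),
        (p (u k) (orbL T (List.take (k : ℕ) (List.ofFn u)) x) *
          Set.indicator (if (k : ℕ) + 1 < n + 1 then Aᶜ else B) (fun _ => (1 : ℝ≥0∞))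
            (orbL T (List.take ((k : ℕ) + 1) (List.ofFn u)) x))
      ∂(Measure.pi fun _ : Fin (n + 1) => ν)
    = (tabooOp (randomMapKernel ν T hT p hp) A)^[n]
        (fun y => randomMapKernel ν T hT p hp y B) x := by
  have hmeas (n : ℕ) (x : X) : Measurable fun u : Fin (n + 1) → W => ∏ k : Fin (n + 1),
        (p (u k) (orbL T (List.take (k : ℕ) (List.ofFn u)) x) *
          Set.indicator (if (k : ℕ) + 1 < n + 1 then Aᶜ else B) (fun _ => (1 : ℝ≥0∞))
            (orbL T (List.take ((k : ℕ) + 1) (List.ofFn u)) x)) := by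
    have horb (j : ℕ) : Measurable fun u : Fin (n + 1) → W =>
        orbL T (List.take j (List.ofFn u)) x :=
      (measurable_orbL_take_ofFn hT j (n + 1)).comp measurable_prodMk_right
    refine Finset.measurable_prod _ fun k _ => Measurable.mul ?_ ?_
    · exact hp.comp ((measurable_pi_apply k).prodMk (horb k))
    · refine (measurable_const.indicator ?_).comp (horb (k + 1))
      split_ifs
      exacts [hA.compl, hB]
  induction n generalizing x with
  | zero =>
    have e := (measurePreserving_funUnique ν (Fin 1)).lintegral_comp_emb
      (MeasurableEquiv.funUnique (Fin 1) W).measurableEmbedding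
      (fun t => p t x * B.indicator (fun _ => (1 : ℝ≥0∞)) (T t x))
    rw [Function.iterate_zero, id, randomMapKernel_apply hB, ← e]
    refine lintegral_congr fun u => ?_
    simp [orbL]
  | succ n ih =>
    have e := (measurePreserving_piFinSuccAbove (fun _ : Fin (n + 2) => ν) 0).symm
    rw [← e.lintegral_comp (hmeas (n + 1) x)]
    refine (lintegral_prod _ ((hmeas (n + 1) x).comp e.measurable).aemeasurable).trans ?_
    rw [
      Function.iterate_succ_apply', tabooOp_randomMapKernel hA
        (measurable_iterate_tabooOp hA (Kernel.measurable_coe _ hB) n)]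
    refine lintegral_congr fun t => ?_
    have hind (F : X → ℝ≥0∞) (z : X) :
        Aᶜ.indicator F z = Aᶜ.indicator (fun _ => (1 : ℝ≥0∞)) z * F z := by
      by_cases hz : z ∈ Aᶜ <;> simp [hz]
    rw [hind, ← ih, ← mul_assoc, ← lintegral_const_mul _ (hmeas n _)]
    refine lintegral_congr fun u => ?_
    have hcons : (MeasurableEquiv.piFinSuccAbove (fun _ : Fin (n + 2) => W) 0).symm (t, u)
        = (Fin.cons t u : Fin (n + 2) → W) := Fin.insertNth_zero' t u
    have hlist : List.ofFn (Fin.cons t u : Fin (n + 2) → W) = t :: List.ofFn u := by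
      rw [List.ofFn_succ]
      simp
    rw [Function.comp_apply, hcons, hlist, Fin.prod_univ_succ]
    simp only [Fin.cons_zero, Fin.cons_succ, Fin.val_zero, Fin.val_succ, List.take_zero,
      List.take_succ_cons, orbL, add_lt_add_iff_right, zero_add]
    rw [if_pos (Nat.one_lt_succ_succ n)]

end RandomMap

/-- Theorem 3.3: if the first return random map `R` of `T` on `A` is well
defined and has an invariant probability measure `μ_A`, then
`μ(D) = Σ_{n≥0} ∫_A Ũ_T^n (U_T 1_D) dμ_A` defines a σ-finite invariant measure for `T`. -/
theorem stmt5
    {W X : Type*} [MeasurableSpace W] [MeasurableSpace X]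
    (ν : Measure W) [SigmaFinite ν] (m : Measure X) [SigmaFinite m]
    (T : W → X → X) (hT : Measurable fun q : W × X => T q.1 q.2)
    (hTns : ∀ t, ∀ D : Set X, MeasurableSet D → m D = 0 → m (T t ⁻¹' D) = 0)
    (p : W → X → ℝ≥0∞) (hp : Measurable fun q : W × X => p q.1 q.2)
    (hpfin : ∀ t x, p t x < ⊤)
    (hpP : ∀ x : X, ∫⁻ t, p t x ∂ν = 1)
    (A : Set X) (hA : MeasurableSet A) (hApos : 0 < m A)
    (hwell : ∀ᵐ x ∂(m.restrict A), ∑' n : ℕ, firstReturnP ν T p A (n + 1) x = 1)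
    (μA : Measure X) (hμA_A : μA A = 1) (hμA_supp : μA Aᶜ = 0)
    (hμAinv : ∀ D : Set X, MeasurableSet D → D ⊆ A →
      ∫⁻ x in A, firstReturnTrans ν T p A x D ∂μA = μA D) :
    ∃ μ : Measure X,
      (∀ D : Set X, MeasurableSet D →
        μ D = ∑' n : ℕ,
          ∫⁻ x in A,
            (fun (f : X → ℝ≥0∞) => fun y => ∫⁻ t, p t y * (Set.indicator Aᶜ f) (T t y) ∂ν)^[n]
              (fun y => ∫⁻ t, p t y * (Set.indicator D (fun _ => (1 : ℝ≥0∞))) (T t y) ∂ν) x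
            ∂μA) ∧
      SigmaFinite μ ∧
      (∀ D : Set X, MeasurableSet D →
        ∫⁻ x, (∫⁻ t, p t x * D.indicator (fun _ => (1 : ℝ≥0∞)) (T t x) ∂ν) ∂μ = μ D) := by
  let κ := randomMapKernel ν T hT p hp
  have : IsMarkovKernel κ := isMarkovKernel_randomMapKernel hpP
  have : IsProbabilityMeasure (μA.restrict A) := ⟨by rw [Measure.restrict_apply_univ, hμA_A]⟩
  have htrans (D : Set X) (hD : MeasurableSet D) (hDA : D ⊆ A) (x : X) :
      firstReturnTrans ν T p A x D = ∑' n : ℕ, (tabooOp κ A)^[n] (fun y => κ y D) x := by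
    refine tsum_congr fun n => ?_
    rw [inter_eq_self_of_subset_right hDA]
    exact lintegral_firstReturn_eq hA hD n x
  have hrestr : (occupation κ A (μA.restrict A)).restrict A = μA.restrict A := by
    ext D hD
    have hDA := hD.inter hA
    rw [Measure.restrict_apply hD, Measure.restrict_apply hD, occupation_apply hA hDA,
      ← hμAinv _ hDA inter_subset_right, ← lintegral_tsum fun n =>
        (measurable_iterate_tabooOp hA (κ.measurable_coe hDA) n).aemeasurable]
    exact lintegral_congr fun x => (htrans _ hDA inter_subset_right x).symm
  refine ⟨occupation κ A (μA.restrict A), fun D hD => ?_, sigmaFinite_occupation hA hrestr,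
    fun D hD => ?_⟩
  · simp only [occupation_apply hA hD, ← randomMapKernel_apply (hT := hT) (hp := hp) hD]
    refine tsum_congr fun n => ?_
    rw [iterate_tabooOp_randomMapKernel hA (κ.measurable_coe hD)]
  · simp only [← randomMapKernel_apply (hT := hT) (hp := hp) hD]
    rw [← Measure.bind_apply hD κ.measurable.aemeasurable, occupation_bind hA hrestr]
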